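/- Let q = r^2 be an even power of a prime, let d_x and d_z be positive integers, and let C be an additive code in F_q^n with d(C^⊥tr) ≥ d_z. Let v_1,…,v_K be K distinct vectors in F_q^n such that d_v := min{ wt_H(v_i − v_j + c) : 1 ≤ i ≠ j ≤ K, c ∈ C } satisfies d_v ≥ d_x. Then there exists an asymmetric quantum code with parameters ((n,K,d_z/d_x))_q. -/

import Mathlib

open scoped Classical

noncomputable section

namespace AQC

/-- Hamming weight of a vector: the number of nonzero entries. -/
def wt {n : ℕ} {α : Type*} [Zero α] (u : Fin n → α) : ℕ :=
  (Finset.univ.filter (fun i => u i ≠ 0)).card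

variable (p m n : ℕ) [Fact p.Prime]

instance : Fintype (GaloisField p m) := Fintype.ofFinite _

/-- Words of length `n` over the field `F_q` with `q = p ^ m`. -/
abbrev Word := Fin n → GaloisField p m

/-- The usual dot product `u · v = ∑ i, u i * v i` on `F_q ^ n`. -/
def dotW (u v : Word p m n) : GaloisField p m := ∑ i, u i * v i

/-- The state space `V_n = ℂ^(F_q^n)`. -/
abbrev QV := Word p m n → ℂ

/-- The trace map `T : F_q → F_p`. -/
def gfTr (x : GaloisField p m) : ZMod p := Algebra.trace (ZMod p) (GaloisField p m) x

/-- `η = exp(2πi/p)`, a primitive `p`-th root of unity. -/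
def eta : ℂ := Complex.exp (2 * Real.pi * Complex.I / p)

/-- The additive character `x ↦ η ^ x` of `F_p`. -/
def chi (x : ZMod p) : ℂ := eta p ^ x.val

/-- The Hermitian inner product `⟨u|v⟩ = ∑ c, conj (u c) * v c` on the state space. -/
def hInner (u v : QV p m n) : ℂ := ∑ c, (starRingEnd ℂ) (u c) * v c

/-- The error operator `e = X(a)Z(b)`, acting by `e|c⟩ = η^{T(b·c)} |a+c⟩`. -/
def errOp (a b : Word p m n) : QV p m n →ₗ[ℂ] QV p m n where
  toFun f := fun x => chi p (gfTr p m (dotW p m n b (x - a))) * f (x - a)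
  map_add' f g := by funext x; simp [mul_add]
  map_smul' c f := by funext x; simp; ring

/-- Purity of an asymmetric quantum code with parameters `((n,K,d_z/d_x))_q`. -/
def IsPureAQEC (Q : Submodule ℂ (QV p m n)) (dz dx : ℕ) : Prop :=
  ∀ u ∈ Q, ∀ v ∈ Q, ∀ a b : Word p m n,
    1 ≤ wt a → wt a ≤ dx - 1 → 1 ≤ wt b → wt b ≤ dz - 1 →
      hInner p m n u (errOp p m n a b v) = 0

/-- `Q` is an asymmetric quantum code with parameters `((n,K,d_z/d_x))_q`:
a `K`-dimensional subspace of `V_n` detecting `d_x - 1` qudits of `X`-errors and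
`d_z - 1` qudits of `Z`-errors; a code with `K = 1` is required to be pure. -/
def IsAQEC (Q : Submodule ℂ (QV p m n)) (K dz dx : ℕ) : Prop :=
  Module.finrank ℂ Q = K ∧ 1 ≤ K ∧
  (∀ u ∈ Q, ∀ v ∈ Q, hInner p m n u v = 0 →
    ∀ a b : Word p m n, wt a ≤ dx - 1 → wt b ≤ dz - 1 →
      hInner p m n u (errOp p m n a b v) = 0) ∧
  (K = 1 → IsPureAQEC p m n Q dz dx)

/-- Minimum distance of a set of words, `ℕ∞`-valued (`⊤` if no nonzero element). -/
def minDistE {n : ℕ} {α : Type*} [Zero α] (S : Set (Fin n → α)) : ℕ∞ :=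
  sInf {d | ∃ u ∈ S, u ≠ 0 ∧ (wt u : ℕ∞) = d}

/-- Trace Hermitian dual of a subset of `F_q^n`, `q = r²`, where conjugation is
`x ↦ x ^ r` and `α` is a fixed nonzero element with `α ^ r = -α` (`α = 1` if `p = 2`,
in which case this is `{u | ∀ v ∈ S, ∑ i, (u i * v i ^ r + u i ^ r * v i) = 0}`). -/
def dualTr (r : ℕ) (α : GaloisField p m) (S : Set (Word p m n)) : Set (Word p m n) :=
  {u | ∀ v ∈ S, α * ∑ i, (u i * (v i) ^ r - (u i) ^ r * v i) = 0}


theorem gfTr_add (p m : ℕ) [Fact p.Prime] (x y : GaloisField p m) :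
    gfTr p m (x + y) = gfTr p m x + gfTr p m y := by
  simp [gfTr]

theorem chi_add (p : ℕ) [Fact p.Prime] (x y : ZMod p) : chi p (x + y) = chi p x * chi p y := by
  have hp : p ≠ 0 := (Fact.out : p.Prime).ne_zero
  have h1 : eta p ^ p = 1 := (Complex.isPrimitiveRoot_exp p hp).pow_eq_one
  unfold chi
  rw [ZMod.val_add, ← pow_add, pow_eq_pow_mod (x.val + y.val) h1]

theorem chi_ne_one (p : ℕ) [Fact p.Prime] (x : ZMod p) (hx : x ≠ 0) : chi p x ≠ 1 := by
  have hp : p ≠ 0 := (Fact.out : p.Prime).ne_zero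
  have h1 : IsPrimitiveRoot (eta p) p := Complex.isPrimitiveRoot_exp p hp
  intro h
  have h2 := h1.dvd_of_pow_eq_one _ h
  have h3 : x.val ≠ 0 := by rwa [Ne, ZMod.val_eq_zero]
  exact absurd (Nat.le_of_dvd (Nat.pos_of_ne_zero h3) h2) (not_le.2 (ZMod.val_lt x))

theorem chi_zero (p : ℕ) [Fact p.Prime] : chi p 0 = 1 := by
  simp [chi]

theorem gfTr_pow_p (p m : ℕ) [Fact p.Prime] (x : GaloisField p m) :
    gfTr p m (x ^ p) = gfTr p m x := by
  have h := Algebra.trace_eq_of_algEquiv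
    (FiniteField.frobeniusAlgEquivOfAlgebraic (ZMod p) (GaloisField p m)) x
  simpa [gfTr, ZMod.card] using h

theorem gfTr_pow (p m f : ℕ) [Fact p.Prime] (x : GaloisField p m) :
    gfTr p m (x ^ p ^ f) = gfTr p m x := by
  induction f with
  | zero => simp
  | succ k ih => rw [pow_succ, pow_mul, gfTr_pow_p, ih]

theorem pow_pow_self (p f : ℕ) [Fact p.Prime] (hf : f ≠ 0) (x : GaloisField p (2 * f)) :
    (x ^ p ^ f) ^ p ^ f = x := by
  have hc : Fintype.card (GaloisField p (2 * f)) = p ^ (2 * f) := by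
    rw [← Nat.card_eq_fintype_card]; exact GaloisField.card p _ (by omega)
  rw [← pow_mul, ← pow_add, ← two_mul, ← hc, FiniteField.pow_card]

theorem relTr_zero (p f : ℕ) [Fact p.Prime] (hf : f ≠ 0) (s : GaloisField p (2 * f))
    (h : ∀ x : GaloisField p (2 * f), x ^ p ^ f = x → gfTr p (2 * f) (x * s) = 0) :
    s + s ^ p ^ f = 0 := by
  have : Algebra.IsSeparable (ZMod p) (GaloisField p (2 * f)) :=
    Algebra.IsAlgebraic.isSeparable_of_perfectField
  refine (traceForm_nondegenerate (ZMod p) (GaloisField p (2 * f))).1 _ fun y => ?_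
  have h1 := h (y + y ^ p ^ f) (by
    rw [add_pow_char_pow, pow_pow_self p f hf, add_comm])
  rw [add_mul, gfTr_add, ← gfTr_pow p (2 * f) f (y ^ p ^ f * s), mul_pow,
    pow_pow_self p f hf, ← gfTr_add, ← mul_add, mul_comm y] at h1
  exact h1

theorem exists_char (p f n dz : ℕ) [Fact p.Prime] (hf : f ≠ 0)
    (α : GaloisField p (2 * f)) (hα0 : α ≠ 0) (hαr : α ^ p ^ f = -α)
    (C : AddSubgroup (Word p (2 * f) n))
    (hlin : ∀ x : GaloisField p (2 * f), x ^ p ^ f = x → ∀ u ∈ C, x • u ∈ C)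
    (hdual : (dz : ℕ∞) ≤ minDistE (dualTr p (2 * f) n (p ^ f) α (C : Set (Word p (2 * f) n))))
    (b : Word p (2 * f) n) (hb0 : b ≠ 0) (hb : wt b < dz) :
    ∃ c ∈ C, gfTr p (2 * f) (dotW p (2 * f) n b c) ≠ 0 := by
  by_contra hcon
  push Not at hcon
  have hpf : p ^ f ≠ 0 := pow_ne_zero _ (Fact.out : p.Prime).ne_zero
  have key : ∀ c ∈ C, dotW p (2 * f) n b c + dotW p (2 * f) n b c ^ p ^ f = 0 := by
    intro c hc
    apply relTr_zero p f hf
    intro x hx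
    have := hcon _ (hlin x hx c hc)
    have e : dotW p (2 * f) n b (x • c) = x * dotW p (2 * f) n b c := by
      simp only [dotW, Finset.mul_sum, Pi.smul_apply, smul_eq_mul]
      exact Finset.sum_congr rfl fun i _ => by ring
    rwa [e] at this
  have hwt : wt (fun i => α * b i ^ p ^ f) = wt b := by
    unfold wt
    congr 1
    ext i
    simp [hα0, hpf, (Fact.out : p.Prime).ne_zero]
  have hle : (dz : ℕ∞) ≤ (wt b : ℕ∞) := by
    refine hdual.trans (sInf_le ⟨fun i => α * b i ^ p ^ f, ?_, ?_, by rw [hwt]⟩)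
    · intro c hc
      have h1 := key c hc
      have e : ∑ i, (α * b i ^ p ^ f * c i ^ p ^ f - (α * b i ^ p ^ f) ^ p ^ f * c i)
          = α * (dotW p (2 * f) n b c + dotW p (2 * f) n b c ^ p ^ f) := by
        unfold dotW
        rw [sum_pow_char_pow, ← Finset.sum_add_distrib, Finset.mul_sum]
        refine Finset.sum_congr rfl fun i _ => ?_
        rw [mul_pow, pow_pow_self p f hf, hαr, mul_pow]
        ring
      rw [e, h1]
      simp
    · intro h0
      apply hb0
      funext i
      have := congrFun h0 i
      simpa [hα0, hpf, (Fact.out : p.Prime).ne_zero] using this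
  have : dz ≤ wt b := by exact_mod_cast hle
  omega

/-- The (unnormalised) coset state. -/
def phi (p m n : ℕ) [Fact p.Prime] (C : AddSubgroup (Word p m n)) (w : Word p m n) : QV p m n :=
  fun x => if x - w ∈ C then 1 else 0

theorem hInner_add_left (p m n : ℕ) [Fact p.Prime] (u u' v : QV p m n) :
    hInner p m n (u + u') v = hInner p m n u v + hInner p m n u' v := by
  simp [hInner, add_mul, Finset.sum_add_distrib]

theorem hInner_add_right (p m n : ℕ) [Fact p.Prime] (u v v' : QV p m n) :
    hInner p m n u (v + v') = hInner p m n u v + hInner p m n u v' := by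
  simp [hInner, mul_add, Finset.sum_add_distrib]

theorem hInner_smul_left (p m n : ℕ) [Fact p.Prime] (a : ℂ) (u v : QV p m n) :
    hInner p m n (a • u) v = (starRingEnd ℂ) a * hInner p m n u v := by
  simp [hInner, Finset.mul_sum, mul_assoc]

theorem hInner_smul_right (p m n : ℕ) [Fact p.Prime] (a : ℂ) (u v : QV p m n) :
    hInner p m n u (a • v) = a * hInner p m n u v := by
  simp only [hInner, Finset.mul_sum, Pi.smul_apply, smul_eq_mul]
  exact Finset.sum_congr rfl fun i _ => by ring

theorem span_KL (p m n : ℕ) [Fact p.Prime] (S : Set (QV p m n)) (E : QV p m n →ₗ[ℂ] QV p m n)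
    (k : ℂ) (h : ∀ u ∈ S, ∀ v ∈ S, hInner p m n u (E v) = k * hInner p m n u v)
    (u : QV p m n) (hu : u ∈ Submodule.span ℂ S) (v : QV p m n) (hv : v ∈ Submodule.span ℂ S) :
    hInner p m n u (E v) = k * hInner p m n u v := by
  induction hu using Submodule.span_induction with
  | mem u hu =>
    induction hv using Submodule.span_induction with
    | mem v hv => exact h u hu v hv
    | zero => simp [hInner]
    | add x y _ _ hx hy => rw [map_add, hInner_add_right, hInner_add_right, hx, hy]; ring
    | smul a x _ hx => rw [map_smul, hInner_smul_right, hInner_smul_right, hx]; ring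
  | zero => simp [hInner]
  | add x y _ _ hx hy => rw [hInner_add_left, hInner_add_left, hx, hy]; ring
  | smul a x _ hx => rw [hInner_smul_left, hInner_smul_left, hx]; ring

theorem phi_off (p m n : ℕ) [Fact p.Prime] (C : AddSubgroup (Word p m n)) (w w' a b : Word p m n)
    (h : a - (w - w') ∉ C) :
    hInner p m n (phi p m n C w) (errOp p m n a b (phi p m n C w')) = 0 := by
  apply Finset.sum_eq_zero
  intro x _
  by_cases h1 : x - w ∈ C
  · by_cases h2 : x - a - w' ∈ C
    · exfalso
      apply h
      have := C.sub_mem h1 h2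
      have e : x - w - (x - a - w') = a - (w - w') := by abel
      rwa [e] at this
    · simp [errOp, phi, h2]
  · simp [phi, h1]

theorem phi_char (p m n : ℕ) [Fact p.Prime] (C : AddSubgroup (Word p m n)) (w w' a b c : Word p m n)
    (hc : c ∈ C) (h : gfTr p m (dotW p m n b c) ≠ 0) :
    hInner p m n (phi p m n C w) (errOp p m n a b (phi p m n C w')) = 0 := by
  have hs : hInner p m n (phi p m n C w) (errOp p m n a b (phi p m n C w'))
      = chi p (gfTr p m (dotW p m n b c)) *
        hInner p m n (phi p m n C w) (errOp p m n a b (phi p m n C w')) := by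
    conv_lhs => rw [hInner, ← Equiv.sum_comp (Equiv.addRight c)]
    rw [hInner, Finset.mul_sum]
    refine Finset.sum_congr rfl fun x _ => ?_
    have e1 : phi p m n C w (x + c) = phi p m n C w x := by
      have : x + c - w = x - w + c := by abel
      simp only [phi, this, C.add_mem_cancel_right hc]
    have e2 : phi p m n C w' (x + c - a) = phi p m n C w' (x - a) := by
      have : x + c - a - w' = x - a - w' + c := by abel
      simp only [phi, this, C.add_mem_cancel_right hc]
    have e3 : dotW p m n b (x + c - a) = dotW p m n b (x - a) + dotW p m n b c := by
      simp only [dotW, ← Finset.sum_add_distrib]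
      exact Finset.sum_congr rfl fun i _ => by simp only [Pi.add_apply, Pi.sub_apply]; ring
    simp only [Equiv.coe_addRight, errOp, LinearMap.coe_mk, AddHom.coe_mk, e1, e2, e3, gfTr_add,
      chi_add]
    ring
  have h1 := chi_ne_one p _ h
  by_contra h0
  exact h1 (mul_right_cancel₀ h0 (by rw [one_mul]; exact hs.symm))

/-- Theorem 3.4: from an additive code `C ⊆ F_q^n`, `q = r²`, with
`d(C^⊥tr) ≥ d_z`, and `K` distinct vectors `v_1, …, v_K` with
`d_v = min{wt(v_i - v_j + c)} ≥ d_x`, one obtains an asymmetric quantum code with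
parameters `((n,K,d_z/d_x))_q`. -/
theorem statement7 (p f n K dx dz : ℕ) [Fact p.Prime] (hf : f ≠ 0) (hn : 0 < n)
    (hdx : 0 < dx) (hdz : 0 < dz)
    (α : GaloisField p (2 * f)) (hα0 : α ≠ 0) (hαr : α ^ p ^ f = -α)
    (hα1 : p = 2 → α = 1)
    (C : AddSubgroup (Word p (2 * f) n))
    (hlin : ∀ x : GaloisField p (2 * f), x ^ p ^ f = x → ∀ u ∈ C, x • u ∈ C)
    (hdual : (dz : ℕ∞) ≤ minDistE (dualTr p (2 * f) n (p ^ f) α (C : Set (Word p (2 * f) n))))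
    (v : Fin K → Word p (2 * f) n) (hv : Function.Injective v)
    (dv : ℕ)
    (hdv : dv = sInf {d | ∃ i j : Fin K, i ≠ j ∧ ∃ c ∈ C, wt (v i - v j + c) = d})
    (hvx : dx ≤ dv) :
    ∃ Q : Submodule ℂ (QV p (2 * f) n), IsAQEC p (2 * f) n Q K dz dx := by
  have hmin : ∀ i j : Fin K, i ≠ j → ∀ c ∈ C, dx ≤ wt (v i - v j + c) := by
    intro i j hij c hc
    refine hvx.trans ?_
    rw [hdv]
    exact Nat.sInf_le ⟨i, j, hij, c, hc, rfl⟩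
  have hK : 2 ≤ K := by
    by_contra hlt
    have he : {d | ∃ i j : Fin K, i ≠ j ∧ ∃ c ∈ C, wt (v i - v j + c) = d} = ∅ := by
      ext d
      simp only [Set.mem_setOf_eq, Set.mem_empty_iff_false, iff_false]
      rintro ⟨i, j, hij, -⟩
      exact hij (Fin.ext (by omega))
    rw [he, Nat.sInf_empty] at hdv
    omega
  have hnot : ∀ i j : Fin K, i ≠ j → ∀ a : Word p (2 * f) n, wt a ≤ dx - 1 →
      a - (v i - v j) ∉ C := by
    intro i j hij a ha hmem
    have h1 := hmin i j hij _ hmem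
    rw [add_sub_cancel] at h1
    omega
  have hLI : LinearIndependent ℂ (fun i => phi p (2 * f) n C (v i)) := by
    rw [Fintype.linearIndependent_iff]
    intro g hg j
    have h1 := congrFun hg (v j)
    rw [Finset.sum_apply, Finset.sum_eq_single j] at h1
    · simpa [phi] using h1
    · intro i _ hij
      have h2 := hnot i j hij 0 (by simp [wt])
      rw [zero_sub, neg_sub] at h2
      simp [phi, h2]
    · simp
  refine ⟨Submodule.span ℂ (Set.range fun i => phi p (2 * f) n C (v i)), ?_, by omega, ?_,
    by omega⟩
  · rw [finrank_span_eq_card hLI, Fintype.card_fin]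
  · intro u hu w hw huw a b ha hb
    have := span_KL p (2 * f) n _ (errOp p (2 * f) n a b) (if b = 0 ∧ a ∈ C then 1 else 0) ?_
      u hu w hw
    · rw [this, huw, mul_zero]
    · rintro _ ⟨i, rfl⟩ _ ⟨j, rfl⟩
      by_cases hb0 : b = 0
      · by_cases haC : a ∈ C
        · have e : errOp p (2 * f) n a b (phi p (2 * f) n C (v j)) = phi p (2 * f) n C (v j) := by
            funext x
            have e2 : x - a - v j = x - v j - a := by abel
            have e3 : x - v j - a ∈ C ↔ x - v j ∈ C := by
              rw [sub_eq_add_neg]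
              exact C.add_mem_cancel_right (C.neg_mem haC)
            simp [errOp, phi, hb0, dotW, gfTr, chi_zero, e2, e3]
          rw [if_pos ⟨hb0, haC⟩, one_mul, e]
        · rw [if_neg (by tauto), zero_mul]
          apply phi_off
          by_cases hij : i = j
          · subst hij; simpa using haC
          · exact hnot i j hij a ha
      · rw [if_neg (by tauto), zero_mul]
        obtain ⟨c, hc, hne⟩ := exists_char p f n dz hf α hα0 hαr C hlin hdual b hb0 (by omega)
        exact phi_char p (2 * f) n C _ _ a b c hc hne
end AQC
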